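/- Let (𝒜, μ_A) be a finite probability space, d ∈ ℕ and τ > 0. Then there exists h = h(μ_A, d, τ) ∈ ℕ such that for every n and every function P : 𝒜^n → ℝ of degree at most d with Var[P] ≤ 1, there is a subset H₀ ⊆ [n] with |H₀| ≤ h such that for every superset H ⊇ H₀, writing T = [n]∖H, one has Pr_{ξ∼μ_A^{⊗H}}[ for all i ∈ T, Inf_i(P_ξ) ≤ τ ] ≥ 1 − τ. -/

import Mathlib

open Finset MeasureTheory ProbabilityTheory Filter
open scoped Classical

noncomputable section

namespace NIS

/-- Expectation of `f` under the weight function `p` on a finite type. -/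
def pmean {Ω : Type*} [Fintype Ω] (p : Ω → ℝ) (f : Ω → ℝ) : ℝ := ∑ ω, p ω * f ω

/-- Variance of `f` under the weight function `p` on a finite type. -/
def pvar {Ω : Type*} [Fintype Ω] (p : Ω → ℝ) (f : Ω → ℝ) : ℝ :=
  pmean p (fun ω => (f ω - pmean p f) ^ 2)

/-- `p` is a probability distribution on the finite type `Ω`. -/
def IsDist {Ω : Type*} [Fintype Ω] (p : Ω → ℝ) : Prop :=
  (∀ ω, 0 ≤ p ω) ∧ ∑ ω, p ω = 1

/-- Probability of the event `E` under the weight function `p`. -/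
def pprob {Ω : Type*} [Fintype Ω] (p : Ω → ℝ) (E : Ω → Prop) : ℝ :=
  ∑ ω, if E ω then p ω else 0

/-- Total variation distance between two distributions on a finite type. -/
def tvDist {Ω : Type*} [Fintype Ω] (p q : Ω → ℝ) : ℝ := (1 / 2) * ∑ ω, |p ω - q ω|

/-- Marginal on the first coordinate of a joint distribution. -/
def marginalA {A B : Type*} [Fintype A] [Fintype B] (μ : A × B → ℝ) : A → ℝ :=
  fun a => ∑ b, μ (a, b)

/-- Marginal on the second coordinate of a joint distribution. -/
def marginalB {A B : Type*} [Fintype A] [Fintype B] (μ : A × B → ℝ) : B → ℝ :=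
  fun b => ∑ a, μ (a, b)

/-- The Hirschfeld–Gebelein–Rényi maximal correlation of a finite joint distribution. -/
def maxCorr {A B : Type*} [Fintype A] [Fintype B] (μ : A × B → ℝ) : ℝ :=
  sSup { r | ∃ f : A → ℝ, ∃ g : B → ℝ,
    pmean (marginalA μ) f = 0 ∧ pmean (marginalB μ) g = 0 ∧
    pvar (marginalA μ) f = 1 ∧ pvar (marginalB μ) g = 1 ∧
    pmean μ (fun ab => f ab.1 * g ab.2) = r }

/-- `n`-fold product distribution of a distribution `μA` on `A`. -/
def prodDist {A : Type*} [Fintype A] (μA : A → ℝ) (n : ℕ) : (Fin n → A) → ℝ :=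
  fun x => ∏ i, μA (x i)

/-- `n`-fold product of a joint distribution `μ` on `A × B`, identified with a distribution on
`A^n × B^n`. -/
def prodPair {A B : Type*} [Fintype A] [Fintype B] (μ : A × B → ℝ) (n : ℕ) :
    (Fin n → A) × (Fin n → B) → ℝ :=
  fun p => ∏ i, μ (p.1 i, p.2 i)

/-- The influence of coordinate `i` on `f : A^n → ℝ` with respect to `μA^{⊗n}`:
`Inf_i(f) = E_{x_{-i}}[Var_{x_i} f] = ½ E_{x, a}[(f(x) - f(x_i ← a))²]`. -/
def influence {A : Type*} [Fintype A] {n : ℕ} (μA : A → ℝ) (i : Fin n)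
    (f : (Fin n → A) → ℝ) : ℝ :=
  (1 / 2) * ∑ x : Fin n → A, ∑ a : A,
    (∏ j, μA (x j)) * μA a * (f x - f (Function.update x i a)) ^ 2

/-- Total influence of `f`. -/
def totalInfluence {A : Type*} [Fintype A] {n : ℕ} (μA : A → ℝ)
    (f : (Fin n → A) → ℝ) : ℝ :=
  ∑ i, influence μA i f

/-- `g` depends on at most `d` coordinates. -/
def DependsOnLE {A : Type*} {n : ℕ} (d : ℕ) (g : (Fin n → A) → ℝ) : Prop :=
  ∃ J : Finset (Fin n), J.card ≤ d ∧
    ∀ x y : Fin n → A, (∀ i ∈ J, x i = y i) → g x = g y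

/-- `f` has degree at most `d`: it lies in the linear span of functions each depending on at
most `d` coordinates. -/
def degLE {A : Type*} {n : ℕ} (d : ℕ) (f : (Fin n → A) → ℝ) : Prop :=
  f ∈ Submodule.span ℝ { g : (Fin n → A) → ℝ | DependsOnLE d g }

/-- Restriction of `P` fixing the coordinates in `H` to the values of `ξ`; the result only
depends on the coordinates outside `H`. -/
def restrictFn {A : Type*} {n : ℕ} (H : Finset (Fin n)) (ξ : Fin n → A)
    (P : (Fin n → A) → ℝ) : (Fin n → A) → ℝ :=
  fun x => P (fun i => if i ∈ H then ξ i else x i)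

/-- The 2-dimensional Gaussian distribution `G(ρ)` with standard normal marginals and
correlation `ρ`. -/
def gauss2 (ρ : ℝ) : Measure (ℝ × ℝ) :=
  Measure.map (fun p : ℝ × ℝ => (p.1, ρ * p.1 + Real.sqrt (1 - ρ ^ 2) * p.2))
    ((gaussianReal 0 1).prod (gaussianReal 0 1))

/-- The standard normal cumulative distribution function `Φ`. -/
def stdNormalCDF (t : ℝ) : ℝ := ((gaussianReal 0 1) (Set.Iic t)).toReal

/-- The inverse `Φ⁻¹` of the standard normal CDF (junk values outside `(0,1)`). -/
def stdNormalCDFInv : ℝ → ℝ := Function.invFun stdNormalCDF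

/-- The ±1-valued threshold function: `thr t r = 1` if `r ≥ t`, and `-1` otherwise. -/
def thr (t r : ℝ) : ℝ := if t ≤ r then 1 else -1

/-- The Gaussian stability quantity `Γ̄_ρ(m, v)`. -/
def Gammabar (ρ m v : ℝ) : ℝ :=
  ∫ q : ℝ × ℝ, (if q.1 ≤ stdNormalCDFInv ((1 + m) / 2) then (1 : ℝ) else -1) *
    (if q.2 ≤ stdNormalCDFInv ((1 + v) / 2) then (1 : ℝ) else -1) ∂(gauss2 ρ)

/-- Pushforward of `μ^{⊗n}` under the pair of maps `(f, g)`. -/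
def push {A B U V : Type*} [Fintype A] [Fintype B] (μ : A × B → ℝ) (n : ℕ)
    (f : (Fin n → A) → U) (g : (Fin n → B) → V) : U × V → ℝ :=
  fun uv => ∑ z : Fin n → A × B,
    if f (fun i => (z i).1) = uv.1 ∧ g (fun i => (z i).2) = uv.2
    then ∏ i, μ (z i) else 0

/-- `ν` can be non-interactively simulated from `μ`. -/
def CanSimulate {A B U V : Type*} [Fintype A] [Fintype B] [Fintype U] [Fintype V]
    (μ : A × B → ℝ) (ν : U × V → ℝ) : Prop :=
  ∃ f : (n : ℕ) → (Fin n → A) → U, ∃ g : (n : ℕ) → (Fin n → B) → V,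
    Tendsto (fun n => tvDist (push μ n (f n) (g n)) ν) atTop (nhds 0)

/-- The doubly symmetric binary source `DSBS(ρ)`, as a distribution on `Bool × Bool`, where
`true` encodes `+1` and `false` encodes `-1`. -/
def DSBS (ρ : ℝ) : Bool × Bool → ℝ :=
  fun bv => if bv.1 = bv.2 then (1 + ρ) / 4 else (1 - ρ) / 4

/-- The ±1 value encoded by a Boolean. -/
def sgn (b : Bool) : ℝ := if b then 1 else -1

/-- Minimum nonzero probability of an atom. -/
def minAtom {A : Type*} [Fintype A] (μA : A → ℝ) : ℝ :=
  sInf { x | ∃ a, μA a = x ∧ 0 < x }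

/-- The hypercontractivity constant `C₄(α)`. -/
def C4 (α : ℝ) : ℝ :=
  if α = 1 / 2 then 3 else
    (((1 - α) / α) ^ ((3 : ℝ) / 4) - ((1 - α) / α) ^ (-((3 : ℝ) / 4))) /
    (((1 - α) / α) ^ ((1 : ℝ) / 4) - ((1 - α) / α) ^ (-((1 : ℝ) / 4)))

section pmean

variable {Ω : Type*} [Fintype Ω] {p : Ω → ℝ}

lemma pmean_add (f g : Ω → ℝ) :
    pmean p (fun ω => f ω + g ω) = pmean p f + pmean p g := by
  simp [pmean, mul_add, Finset.sum_add_distrib]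

lemma pmean_sub (f g : Ω → ℝ) :
    pmean p (fun ω => f ω - g ω) = pmean p f - pmean p g := by
  simp [pmean, mul_sub, Finset.sum_sub_distrib]

lemma pmean_const_mul (c : ℝ) (f : Ω → ℝ) :
    pmean p (fun ω => c * f ω) = c * pmean p f := by
  simp only [pmean, Finset.mul_sum]
  exact Finset.sum_congr rfl fun _ _ => by ring

lemma pmean_sum {ι : Type*} (s : Finset ι) (f : ι → Ω → ℝ) :
    pmean p (fun ω => ∑ i ∈ s, f i ω) = ∑ i ∈ s, pmean p (f i) := by
  simp only [pmean, Finset.mul_sum]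
  exact Finset.sum_comm

lemma pmean_comm {Ω' : Type*} [Fintype Ω'] (p : Ω → ℝ) (q : Ω' → ℝ)
    (F : Ω → Ω' → ℝ) :
    pmean p (fun a => pmean q (F a)) = pmean q (fun b => pmean p (fun a => F a b)) := by
  simp only [pmean, Finset.mul_sum]
  rw [Finset.sum_comm]
  exact Finset.sum_congr rfl fun a _ => Finset.sum_congr rfl fun x _ => by ring

lemma pmean_const (hp : IsDist p) (c : ℝ) : pmean p (fun _ => c) = c := by
  simp [pmean, ← Finset.sum_mul, hp.2]

lemma pmean_mono (hp : IsDist p) {f g : Ω → ℝ} (h : ∀ ω, f ω ≤ g ω) :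
    pmean p f ≤ pmean p g :=
  Finset.sum_le_sum fun ω _ => mul_le_mul_of_nonneg_left (h ω) (hp.1 ω)

lemma pmean_nonneg (hp : IsDist p) {f : Ω → ℝ} (h : ∀ ω, 0 ≤ f ω) : 0 ≤ pmean p f :=
  Finset.sum_nonneg fun ω _ => mul_nonneg (hp.1 ω) (h ω)

/-- Cauchy–Schwarz inequality. -/
lemma pmean_mul_sq_le (hp : IsDist p) (f g : Ω → ℝ) :
    pmean p (fun ω => f ω * g ω) ^ 2 ≤
      pmean p (fun ω => f ω ^ 2) * pmean p (fun ω => g ω ^ 2) :=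
  Finset.sum_sq_le_sum_mul_sum_of_sq_le_mul _
    (fun ω _ => mul_nonneg (hp.1 ω) (sq_nonneg _))
    (fun ω _ => mul_nonneg (hp.1 ω) (sq_nonneg _)) (fun ω _ => le_of_eq (by ring))

/-- Jensen's inequality for the square. -/
lemma sq_pmean_le (hp : IsDist p) (f : Ω → ℝ) :
    pmean p f ^ 2 ≤ pmean p (fun ω => f ω ^ 2) := by
  simpa [pmean_const hp] using pmean_mul_sq_le hp f (fun _ => 1)

/-- Pythagoras: a constant is orthogonal to centred functions. -/
lemma pmean_const_add_sq (hp : IsDist p) (s : ℝ) {t : Ω → ℝ} (ht : pmean p t = 0) :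
    pmean p (fun ω => (s + t ω) ^ 2) = s ^ 2 + pmean p (fun ω => t ω ^ 2) := by
  have h : (fun ω => (s + t ω) ^ 2) = fun ω => (s ^ 2 + 2 * s * t ω) + t ω ^ 2 := by
    funext ω; ring
  rw [h, pmean_add, pmean_add (fun _ => s ^ 2), pmean_const hp, pmean_const_mul, ht]
  ring

/-- Twice the variance is the mean square of the difference of two independent copies. -/
lemma pmean_pmean_sub_sq (hp : IsDist p) {t : Ω → ℝ} (ht : pmean p t = 0) :
    pmean p (fun a => pmean p (fun b => (t a - t b) ^ 2)) = 2 * pmean p (fun a => t a ^ 2) := by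
  have hneg : pmean p (fun b => -t b) = 0 := by
    simpa [ht] using pmean_const_mul (p := p) (-1) t
  have h (a : Ω) : pmean p (fun b => (t a - t b) ^ 2) = t a ^ 2 + pmean p (fun b => t b ^ 2) := by
    simpa [sub_eq_add_neg] using pmean_const_add_sq hp (t a) hneg
  simp only [h]
  rw [pmean_add (fun a => t a ^ 2), pmean_const hp]
  ring

lemma pprob_add_pprob_not (hp : IsDist p) (E : Ω → Prop) :
    pprob p E + pprob p (fun ω => ¬ E ω) = 1 := by
  rw [← hp.2, pprob, pprob, ← Finset.sum_add_distrib]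
  refine Finset.sum_congr rfl fun ω _ => ?_
  by_cases h : E ω <;> simp [h]

/-- If one of the functions `Y i` exceeds `τ` whenever `E` holds, then `E` is controlled by the
second moments of the `Y i`. -/
lemma pprob_mul_sq_le_sum (hp : IsDist p) {ι : Type*} (s : Finset ι) (Y : ι → Ω → ℝ) {τ : ℝ}
    (hτ : 0 < τ) {E : Ω → Prop} (hE : ∀ ω, E ω → ∃ i ∈ s, τ < Y i ω) :
    pprob p E * τ ^ 2 ≤ ∑ i ∈ s, pmean p (fun ω => Y i ω ^ 2) := by
  rw [← pmean_sum, pprob, Finset.sum_mul]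
  refine Finset.sum_le_sum fun ω _ => ?_
  have hnn : ∀ i ∈ s, 0 ≤ Y i ω ^ 2 := fun i _ => sq_nonneg _
  split_ifs with h
  · obtain ⟨i, hi, hlt⟩ := hE ω h
    refine mul_le_mul_of_nonneg_left ?_ (hp.1 ω)
    exact (pow_le_pow_left₀ hτ.le hlt.le 2).trans (Finset.single_le_sum hnn hi)
  · simpa using mul_nonneg (hp.1 ω) (Finset.sum_nonneg hnn)

/-- On a finite probability space the `L²` norm is controlled by the `L¹` norm, up to the inverse
of the least nonzero mass of an atom. -/
lemma exists_pmean_sq_le (p : Ω → ℝ) (hp : IsDist p) : ∃ L : ℝ, 1 ≤ L ∧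
    ∀ f : Ω → ℝ, (∀ ω, 0 ≤ f ω) → pmean p (fun ω => f ω ^ 2) ≤ L * pmean p f ^ 2 := by
  have hinv (ω : Ω) : 0 ≤ (p ω)⁻¹ := inv_nonneg.2 (hp.1 ω)
  refine ⟨1 + ∑ ω, (p ω)⁻¹, by simpa using Finset.sum_nonneg fun ω _ => hinv ω,
    fun f hf => ?_⟩
  have hL (ω : Ω) : p ω ≤ (1 + ∑ ω, (p ω)⁻¹) * p ω ^ 2 := by
    rcases (hp.1 ω).eq_or_lt with h | h
    · simp [← h]
    · have h1 : (p ω)⁻¹ ≤ 1 + ∑ ω, (p ω)⁻¹ := by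
        have := Finset.single_le_sum (fun ω _ => hinv ω) (Finset.mem_univ ω)
        linarith
      calc p ω = (p ω)⁻¹ * p ω ^ 2 := by field_simp
        _ ≤ _ := by gcongr
  calc pmean p (fun ω => f ω ^ 2) ≤ ∑ ω, (1 + ∑ ω, (p ω)⁻¹) * (p ω * f ω) ^ 2 :=
        Finset.sum_le_sum fun ω _ => by
          have := mul_le_mul_of_nonneg_right (hL ω) (sq_nonneg (f ω))
          linarith
    _ = (1 + ∑ ω, (p ω)⁻¹) * ∑ ω, (p ω * f ω) ^ 2 := by rw [Finset.mul_sum]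
    _ ≤ _ := by
      have hL0 : 0 ≤ 1 + ∑ ω, (p ω)⁻¹ :=
        add_nonneg zero_le_one (Finset.sum_nonneg fun ω _ => hinv ω)
      exact mul_le_mul_of_nonneg_left
        (Finset.sum_sq_le_sq_sum_of_nonneg fun ω _ => mul_nonneg (hp.1 ω) (hf ω)) hL0

end pmean

section degree

variable {A : Type*} {n d : ℕ}

lemma degLE.comp_of_dependsOnLE {m e : ℕ} {f : (Fin n → A) → ℝ} (hf : degLE d f)
    (T : ((Fin n → A) → ℝ) →ₗ[ℝ] ((Fin m → A) → ℝ))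
    (hT : ∀ g, DependsOnLE d g → degLE e (T g)) : degLE e (T f) := by
  have h : Submodule.span ℝ {g : (Fin n → A) → ℝ | DependsOnLE d g} ≤
      (Submodule.span ℝ {g : (Fin m → A) → ℝ | DependsOnLE e g}).comap T :=
    Submodule.span_le.2 fun g hg => hT g hg
  exact h hf

lemma degLE.sub {f g : (Fin n → A) → ℝ} (hf : degLE d f) (hg : degLE d g) :
    degLE d (fun x => f x - g x) :=
  Submodule.sub_mem _ hf hg

lemma degLE.sum_mul {ι : Type*} {s : Finset ι} (w : ι → ℝ) {f : ι → (Fin n → A) → ℝ}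
    (hf : ∀ i ∈ s, degLE d (f i)) : degLE d (fun x => ∑ i ∈ s, w i * f i x) := by
  have h : (fun x => ∑ i ∈ s, w i * f i x) = ∑ i ∈ s, w i • f i := by
    funext x; simp
  rw [h]
  exact Submodule.sum_mem _ fun i hi => Submodule.smul_mem _ _ (hf i hi)

lemma degLE_const (c : ℝ) : degLE d (fun _ : Fin n → A => c) :=
  Submodule.subset_span ⟨∅, by simp, fun _ _ _ => rfl⟩

lemma degLE.eq_of_zero {f : (Fin n → A) → ℝ} (hf : degLE 0 f) (x y : Fin n → A) :
    f x = f y := by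
  induction hf using Submodule.span_induction with
  | mem g hg =>
    obtain ⟨J, hJ, hg⟩ := hg
    exact hg x y (by simp [Finset.card_eq_zero.1 (Nat.le_zero.1 hJ)])
  | zero => rfl
  | add f g _ _ hf hg => simp [hf, hg]
  | smul c f _ hf => simp [hf]

lemma degLE.update {f : (Fin n → A) → ℝ} (hf : degLE d f) (i : Fin n) (a : A) :
    degLE d (fun x => f (Function.update x i a)) := by
  refine hf.comp_of_dependsOnLE (LinearMap.funLeft ℝ ℝ fun x => Function.update x i a) ?_
  rintro g ⟨J, hJ, hg⟩
  refine Submodule.subset_span ⟨J, hJ, fun x y hxy => hg _ _ fun j hj => ?_⟩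
  by_cases h : j = i
  · subst h; simp
  · simp [h, hxy j hj]

lemma degLE.cons {f : (Fin (n + 1) → A) → ℝ} (hf : degLE d f) (a : A) :
    degLE d (fun x : Fin n → A => f (Fin.cons a x)) := by
  refine hf.comp_of_dependsOnLE (LinearMap.funLeft ℝ ℝ fun x => Fin.cons a x) ?_
  rintro g ⟨J, hJ, hg⟩
  refine Submodule.subset_span ⟨J.preimage Fin.succ (Fin.succ_injective n).injOn, ?_,
    fun x y hxy => hg _ _ fun j hj => ?_⟩
  · refine le_trans ?_ hJ
    exact Finset.card_le_card_of_injOn Fin.succ (fun j hj => by simpa using hj)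
      (Fin.succ_injective n).injOn
  · cases j using Fin.cases with
    | zero => rfl
    | succ j => simpa using hxy j (by simpa using hj)

/-- Discrete derivatives in the first coordinate lower the degree. -/
lemma degLE.cons_sub_cons {f : (Fin (n + 1) → A) → ℝ} (hf : degLE (d + 1) f) (a b : A) :
    degLE d (fun x : Fin n → A => f (Fin.cons a x) - f (Fin.cons b x)) := by
  refine hf.comp_of_dependsOnLE (LinearMap.funLeft ℝ ℝ (fun x => Fin.cons a x) -
    LinearMap.funLeft ℝ ℝ (fun x => Fin.cons b x)) ?_
  rintro g ⟨J, hJ, hg⟩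
  by_cases h0 : (0 : Fin (n + 1)) ∈ J
  · have key (c : A) (x y : Fin n → A)
        (hxy : ∀ i ∈ J.preimage Fin.succ (Fin.succ_injective n).injOn, x i = y i) :
        g (Fin.cons c x) = g (Fin.cons c y) := by
      refine hg _ _ fun j hj => ?_
      cases j using Fin.cases with
      | zero => rfl
      | succ j => simpa using hxy j (by simpa using hj)
    refine Submodule.subset_span ⟨J.preimage Fin.succ (Fin.succ_injective n).injOn, ?_,
      fun x y hxy => ?_⟩
    · have h1 : (J.preimage Fin.succ (Fin.succ_injective n).injOn).card ≤ (J.erase 0).card :=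
        Finset.card_le_card_of_injOn Fin.succ (fun j hj => by simpa using hj)
          (Fin.succ_injective n).injOn
      rw [Finset.card_erase_of_mem h0] at h1
      omega
    · simp only [LinearMap.sub_apply, Pi.sub_apply, LinearMap.funLeft_apply]
      rw [key a x y hxy, key b x y hxy]
  · have h : (LinearMap.funLeft ℝ ℝ (fun x : Fin n → A => (Fin.cons a x : Fin (n + 1) → A)) -
        LinearMap.funLeft ℝ ℝ (fun x : Fin n → A => (Fin.cons b x : Fin (n + 1) → A))) g = 0 := by
      funext x
      simp only [LinearMap.sub_apply, Pi.sub_apply, LinearMap.funLeft_apply, Pi.zero_apply,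
        sub_eq_zero]
      refine hg _ _ fun j hj => ?_
      cases j using Fin.cases with
      | zero => exact absurd hj h0
      | succ j => rfl
    rw [h]
    exact Submodule.zero_mem _

end degree

section product

variable {A : Type*} [Fintype A] {μA : A → ℝ} {n d : ℕ}

lemma pmean_prodDist_succ (f : (Fin (n + 1) → A) → ℝ) :
    pmean (prodDist μA (n + 1)) f =
      pmean μA (fun a => pmean (prodDist μA n) (fun x => f (Fin.cons a x))) := by
  simp only [pmean, prodDist, Finset.mul_sum]
  rw [← Fintype.sum_prod_type', ← (Fin.consEquiv fun _ => A).sum_comp]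
  refine Finset.sum_congr rfl fun x _ => ?_
  simp [Fin.consEquiv, Fin.prod_univ_succ, mul_assoc]

lemma isDist_prodDist (hμA : IsDist μA) (n : ℕ) : IsDist (prodDist μA n) := by
  refine ⟨fun x => Finset.prod_nonneg fun i _ => hμA.1 _, ?_⟩
  simp only [prodDist]
  rw [← Fintype.piFinset_univ, ← Finset.prod_univ_sum (fun _ => Finset.univ) (fun _ a => μA a)]
  simp [hμA.2]

/-- Resampling the coordinates outside `H` preserves the product distribution. -/
lemma pmean_pmean_mix (hμA : IsDist μA) (H : Finset (Fin n)) (F : (Fin n → A) → ℝ) :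
    pmean (prodDist μA n) (fun ξ => pmean (prodDist μA n)
      (fun x => F (fun i => if i ∈ H then ξ i else x i))) = pmean (prodDist μA n) F := by
  have hp := isDist_prodDist hμA n
  let mix : (Fin n → A) × (Fin n → A) → (Fin n → A) × (Fin n → A) := fun q =>
    (fun i => if i ∈ H then q.1 i else q.2 i, fun i => if i ∈ H then q.2 i else q.1 i)
  have hmix : Function.Involutive mix := fun q => by
    ext i <;> by_cases h : i ∈ H <;> simp [mix, h]
  calc _ = ∑ q : (Fin n → A) × (Fin n → A),
        prodDist μA n q.1 * (prodDist μA n q.2 * F (mix q).1) := by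
        simp only [pmean, Finset.mul_sum]
        rw [← Fintype.sum_prod_type']
    _ = ∑ q : (Fin n → A) × (Fin n → A),
        prodDist μA n q.1 * (prodDist μA n q.2 * F q.1) := by
        rw [← Equiv.sum_comp hmix.toPerm]
        refine Finset.sum_congr rfl fun q _ => ?_
        have hw : prodDist μA n (mix q).1 * prodDist μA n (mix q).2 =
            prodDist μA n q.1 * prodDist μA n q.2 := by
          simp only [prodDist, ← Finset.prod_mul_distrib]
          refine Finset.prod_congr rfl fun i _ => ?_
          by_cases h : i ∈ H <;> simp [mix, h, mul_comm]
        have hq : mix (mix q) = q := hmix q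
        change prodDist μA n (mix q).1 * (prodDist μA n (mix q).2 * F (mix (mix q)).1) = _
        rw [hq, ← mul_assoc, hw, mul_assoc]
    _ = pmean (prodDist μA n) (fun ξ => pmean (prodDist μA n) (fun _ => F ξ)) := by
        simp only [pmean, Finset.mul_sum]
        rw [← Fintype.sum_prod_type']
    _ = _ := by simp only [pmean_const hp]

lemma influence_eq_pmean (i : Fin n) (f : (Fin n → A) → ℝ) :
    influence μA i f = (1 / 2) * pmean μA (fun a =>
      pmean (prodDist μA n) (fun x => (f x - f (Function.update x i a)) ^ 2)) := by
  simp only [influence, pmean, prodDist, Finset.mul_sum]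
  rw [Finset.sum_comm]
  exact Finset.sum_congr rfl fun a _ => Finset.sum_congr rfl fun x _ => by ring

lemma influence_nonneg (hμA : IsDist μA) (i : Fin n) (f : (Fin n → A) → ℝ) :
    0 ≤ influence μA i f := by
  rw [influence_eq_pmean]
  exact mul_nonneg (by norm_num) (pmean_nonneg hμA fun a =>
    pmean_nonneg (isDist_prodDist hμA n) fun x => sq_nonneg _)

/-- The average of `f` over its first coordinate. -/
def headMean (μA : A → ℝ) (f : (Fin (n + 1) → A) → ℝ) (x : Fin n → A) : ℝ :=
  pmean μA (fun a => f (Fin.cons a x))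

/-- The part of `f` that is centred in its first coordinate, as a function of the others. -/
def headDiff (μA : A → ℝ) (f : (Fin (n + 1) → A) → ℝ) (a : A) (x : Fin n → A) : ℝ :=
  f (Fin.cons a x) - headMean μA f x

lemma headMean_add_headDiff (f : (Fin (n + 1) → A) → ℝ) (a : A) (x : Fin n → A) :
    headMean μA f x + headDiff μA f a x = f (Fin.cons a x) := by
  simp [headDiff]

lemma pmean_headDiff (hμA : IsDist μA) (f : (Fin (n + 1) → A) → ℝ) (x : Fin n → A) :
    pmean μA (fun a => headDiff μA f a x) = 0 := by
  simp only [headDiff]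
  rw [pmean_sub (fun a => f (Fin.cons a x)), pmean_const hμA]
  simp [headMean]

lemma degLE.headMean {f : (Fin (n + 1) → A) → ℝ} (hf : degLE d f) :
    degLE d (headMean μA f) :=
  degLE.sum_mul μA fun a _ => hf.cons a

lemma degLE.headDiff (hμA : IsDist μA) {f : (Fin (n + 1) → A) → ℝ} (hf : degLE (d + 1) f)
    (a : A) : degLE d (headDiff μA f a) := by
  have h : NIS.headDiff μA f a =
      fun x => ∑ b, μA b * (f (Fin.cons a x) - f (Fin.cons b x)) := by
    funext x
    simp only [mul_sub, Finset.sum_sub_distrib, ← Finset.sum_mul, hμA.2, one_mul]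
    rfl
  rw [h]
  exact degLE.sum_mul μA fun b _ => hf.cons_sub_cons a b

lemma pmean_sq_succ (hμA : IsDist μA) (f : (Fin (n + 1) → A) → ℝ) :
    pmean (prodDist μA (n + 1)) (fun x => f x ^ 2) =
      pmean (prodDist μA n) (fun x => headMean μA f x ^ 2) +
        pmean μA (fun a => pmean (prodDist μA n) (fun x => headDiff μA f a x ^ 2)) := by
  rw [pmean_prodDist_succ, pmean_comm, pmean_comm (F := fun a x => headDiff μA f a x ^ 2),
    ← pmean_add]
  congr 1
  funext x
  rw [← pmean_const_add_sq hμA _ (pmean_headDiff hμA f x)]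
  simp only [headMean_add_headDiff]

lemma pmean_pow_four_succ_le (hμA : IsDist μA) (f : (Fin (n + 1) → A) → ℝ) :
    pmean (prodDist μA (n + 1)) (fun x => f x ^ 4) ≤
      pmean (prodDist μA n) (fun x => headMean μA f x ^ 4) +
      8 * pmean μA (fun a => pmean (prodDist μA n)
        (fun x => headMean μA f x ^ 2 * headDiff μA f a x ^ 2)) +
      3 * pmean μA (fun a => pmean (prodDist μA n) (fun x => headDiff μA f a x ^ 4)) := by
  rw [pmean_prodDist_succ, pmean_comm, pmean_comm (F := fun a x => headDiff μA f a x ^ 4),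
    pmean_comm (F := fun a x => headMean μA f x ^ 2 * headDiff μA f a x ^ 2),
    ← pmean_const_mul, ← pmean_const_mul, ← pmean_add, ← pmean_add]
  refine pmean_mono (isDist_prodDist hμA n) fun x => ?_
  set g := headMean μA f x
  have h : pmean μA (fun a => f (Fin.cons a x) ^ 4) ≤
      pmean μA (fun a => ((g ^ 4 + 4 * g ^ 3 * headDiff μA f a x) +
        8 * (g ^ 2 * headDiff μA f a x ^ 2)) + 3 * headDiff μA f a x ^ 4) := by
    refine pmean_mono hμA fun a => ?_
    rw [← headMean_add_headDiff (μA := μA) f a x]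
    have := mul_nonneg (sq_nonneg (headDiff μA f a x)) (sq_nonneg (g - headDiff μA f a x))
    change (g + headDiff μA f a x) ^ 4 ≤ _
    linear_combination 2 * this
  rw [pmean_const_mul]
  rwa [pmean_add (fun a => (g ^ 4 + 4 * g ^ 3 * headDiff μA f a x) +
        8 * (g ^ 2 * headDiff μA f a x ^ 2)), pmean_add (fun a => g ^ 4 + _), pmean_add,
    pmean_const hμA, pmean_const_mul, pmean_const_mul, pmean_const_mul, pmean_const_mul, pmean_headDiff hμA,
    mul_zero, add_zero] at h

/-- Hypercontractivity: the fourth moment of a low degree function is controlled by the square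
of its second moment. -/
theorem pmean_pow_four_le (hμA : IsDist μA) {L : ℝ} (hL : 1 ≤ L)
    (hμL : ∀ f : A → ℝ, (∀ a, 0 ≤ f a) → pmean μA (fun a => f a ^ 2) ≤ L * pmean μA f ^ 2)
    {n d : ℕ} {f : (Fin n → A) → ℝ} (hf : degLE d f) :
    pmean (prodDist μA n) (fun x => f x ^ 4) ≤
      ((4 * L) ^ 2) ^ d * pmean (prodDist μA n) (fun x => f x ^ 2) ^ 2 := by
  induction n generalizing d with
  | zero =>
    have hK : 1 ≤ ((4 * L) ^ 2) ^ d := one_le_pow₀ (one_le_pow₀ (by linarith))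
    simp only [pmean, prodDist, Finset.univ_unique, Finset.sum_singleton, Finset.univ_eq_empty,
      Finset.prod_empty, one_mul]
    have := mul_le_mul_of_nonneg_right hK (pow_nonneg (sq_nonneg (f default)) 2)
    linarith
  | succ n ih =>
    have hp := isDist_prodDist hμA n
    cases d with
    | zero =>
      rcases isEmpty_or_nonempty (Fin (n + 1) → A) with h | ⟨⟨x₀⟩⟩
      · simp [pmean]
      · have hc : f = fun _ => f x₀ := funext fun x => hf.eq_of_zero x x₀
        rw [hc]
        simp only [pmean_const (isDist_prodDist hμA (n + 1))]
        apply le_of_eq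
        ring
    | succ d =>
      have hg := ih (hf.headMean (μA := μA))
      have hh (a : A) := ih (hf.headDiff hμA a)
      have h4 := pmean_pow_four_succ_le hμA f
      rw [pmean_sq_succ hμA f]
      set G := pmean (prodDist μA n) (fun x => headMean μA f x ^ 2)
      set R := ((4 * L) ^ 2) ^ d
      let D : A → ℝ := fun a => pmean (prodDist μA n) (fun x => headDiff μA f a x ^ 2)
      have hR : 0 ≤ R := by positivity
      have hG : 0 ≤ G := pmean_nonneg hp fun x => sq_nonneg _
      have hD (a : A) : 0 ≤ D a := pmean_nonneg hp fun x => sq_nonneg _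
      have hmixed (a : A) : pmean (prodDist μA n)
          (fun x => headMean μA f x ^ 2 * headDiff μA f a x ^ 2) ≤ 4 * L * R * G * D a := by
        have hDa := hD a
        refine (abs_le_of_sq_le_sq' ?_ (by positivity)).2
        refine (pmean_mul_sq_le hp _ _).trans ?_
        simp only [← pow_mul, Nat.reduceMul]
        refine (mul_le_mul hg (hh a) (pmean_nonneg hp fun x => by positivity)
          (by positivity)).trans (le_of_eq ?_)
        change ((4 * L) ^ 2) ^ (d + 1) * G ^ 2 * (R * D a ^ 2) = _
        rw [pow_succ]
        ring
      have h1 : pmean μA (fun a => pmean (prodDist μA n)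
          (fun x => headMean μA f x ^ 2 * headDiff μA f a x ^ 2)) ≤
          4 * L * R * G * pmean μA D := by
        rw [← pmean_const_mul]
        exact pmean_mono hμA hmixed
      have h2 : pmean μA (fun a => pmean (prodDist μA n) (fun x => headDiff μA f a x ^ 4)) ≤
          R * (L * pmean μA D ^ 2) := by
        refine (pmean_mono hμA hh).trans ?_
        rw [pmean_const_mul]
        exact mul_le_mul_of_nonneg_left (hμL D hD) hR
      have hE : 0 ≤ pmean μA D := pmean_nonneg hμA hD
      change _ ≤ ((4 * L) ^ 2) ^ (d + 1) * (G + pmean μA D) ^ 2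
      rw [pow_succ] at hg ⊢
      have h3 : 0 ≤ R * (G * pmean μA D) * (L * (L - 1)) :=
        mul_nonneg (by positivity) (mul_nonneg (by linarith) (by linarith))
      have h5 : 0 ≤ R * pmean μA D ^ 2 * (L * (16 * L - 3)) :=
        mul_nonneg (by positivity) (mul_nonneg (by linarith) (by linarith))
      linear_combination h4 + hg + 8 * h1 + 3 * h2 + 32 * h3 + h5

lemma influence_succ (hμA : IsDist μA) (f : (Fin (n + 1) → A) → ℝ) (i : Fin n) :
    influence μA i.succ f = influence μA i (headMean μA f) +
      pmean μA (fun c => influence μA i (headDiff μA f c)) := by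
  simp only [influence_eq_pmean]
  rw [pmean_const_mul, ← mul_add, pmean_comm μA μA, ← pmean_add]
  congr 2
  funext a
  rw [pmean_prodDist_succ, pmean_comm,
    pmean_comm (F := fun c x => (headDiff μA f c x - headDiff μA f c (Function.update x i a)) ^ 2),
    ← pmean_add]
  congr 1
  funext x
  rw [← pmean_const_add_sq hμA]
  · congr 1
    funext c
    rw [← Fin.cons_update, ← headMean_add_headDiff (μA := μA) f c x,
      ← headMean_add_headDiff (μA := μA) f c (Function.update x i a)]
    ring
  · rw [pmean_sub (fun c => headDiff μA f c x), pmean_headDiff hμA, pmean_headDiff hμA, sub_zero]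

lemma influence_zero (hμA : IsDist μA) (f : (Fin (n + 1) → A) → ℝ) :
    influence μA 0 f =
      pmean μA (fun a => pmean (prodDist μA n) (fun x => headDiff μA f a x ^ 2)) := by
  rw [influence_eq_pmean]
  simp only [pmean_prodDist_succ, Fin.update_cons_zero]
  rw [pmean_comm μA (prodDist μA n)]
  have (b : A) := pmean_comm μA (prodDist μA n)
    (fun a x => (f (Fin.cons a x) - f (Fin.cons b x)) ^ 2)
  simp only [this]
  rw [pmean_comm μA (prodDist μA n), ← pmean_const_mul]
  congr 1
  funext x
  have h := pmean_pmean_sub_sq hμA (pmean_headDiff hμA f x)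
  rw [pmean_comm] at h
  simp only [headDiff, sub_sub_sub_cancel_right] at h ⊢
  rw [h]
  ring

/-- The total influence of a function of degree `d` is at most `d` times its second moment. -/
theorem totalInfluence_le_mul_pmean_sq (hμA : IsDist μA) {n d : ℕ} {f : (Fin n → A) → ℝ}
    (hf : degLE d f) :
    totalInfluence μA f ≤ d * pmean (prodDist μA n) (fun x => f x ^ 2) := by
  induction n generalizing d with
  | zero =>
    simp only [totalInfluence, Finset.univ_eq_empty, Finset.sum_empty]
    exact mul_nonneg (Nat.cast_nonneg d)
      (pmean_nonneg (isDist_prodDist hμA 0) fun x => sq_nonneg _)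
  | succ n ih =>
    cases d with
    | zero =>
      have h (i : Fin (n + 1)) : influence μA i f = 0 := by
        have hc (x : Fin (n + 1) → A) (a : A) : f x - f (Function.update x i a) = 0 :=
          sub_eq_zero.2 (hf.eq_of_zero _ _)
        simp [influence, hc]
      simp [totalInfluence, h]
    | succ d =>
      have hg := ih (hf.headMean (μA := μA))
      have hh := pmean_mono hμA fun a => ih (hf.headDiff hμA a)
      rw [pmean_const_mul] at hh
      have hsum : totalInfluence μA f =
          pmean μA (fun a => pmean (prodDist μA n) (fun x => headDiff μA f a x ^ 2)) +
          (totalInfluence μA (headMean μA f) +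
            pmean μA (fun a => totalInfluence μA (headDiff μA f a))) := by
        simp only [totalInfluence]
        rw [Fin.sum_univ_succ, influence_zero hμA, pmean_sum, ← Finset.sum_add_distrib]
        simp only [influence_succ hμA]
      rw [hsum, pmean_sq_succ hμA f]
      push_cast at hg ⊢
      linarith

lemma totalInfluence_le_mul_pvar (hμA : IsDist μA) {f : (Fin n → A) → ℝ} (hf : degLE d f) :
    totalInfluence μA f ≤ d * pvar (prodDist μA n) f := by
  have h := totalInfluence_le_mul_pmean_sq hμA
    (hf.sub (degLE_const (pmean (prodDist μA n) f)))
  simpa [totalInfluence, influence, pvar] using h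

/-- The second moment of an influence of a random restriction. -/
lemma pmean_influence_restrictFn_sq_le (hμA : IsDist μA) {L : ℝ} (hL : 1 ≤ L)
    (hμL : ∀ f : A → ℝ, (∀ a, 0 ≤ f a) → pmean μA (fun a => f a ^ 2) ≤ L * pmean μA f ^ 2)
    {P : (Fin n → A) → ℝ} (hP : degLE d P) (H : Finset (Fin n)) {i : Fin n} (hi : i ∉ H) :
    pmean (prodDist μA n) (fun ξ => influence μA i (restrictFn H ξ P) ^ 2) ≤
      ((4 * L) ^ 2) ^ d * L * influence μA i P ^ 2 := by
  have hp := isDist_prodDist hμA n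
  let D : A → (Fin n → A) → ℝ := fun a x => P x - P (Function.update x i a)
  have hD (a : A) : degLE d (D a) := hP.sub (hP.update i a)
  have hInf (ξ : Fin n → A) : influence μA i (restrictFn H ξ P) = (1 / 2) *
      pmean μA (fun a => pmean (prodDist μA n)
        (fun x => D a (fun j => if j ∈ H then ξ j else x j) ^ 2)) := by
    rw [influence_eq_pmean]
    congr! 7 with a x
    simp only [restrictFn]
    congr 2
    funext j
    by_cases hj : j = i
    · subst hj; simp [hi]
    · simp [hj]
  have hJensen (ξ : Fin n → A) : influence μA i (restrictFn H ξ P) ^ 2 ≤ (1 / 4) *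
      pmean μA (fun a => pmean (prodDist μA n)
        (fun x => D a (fun j => if j ∈ H then ξ j else x j) ^ 4)) := by
    rw [hInf, mul_pow]
    have h1 := sq_pmean_le hμA (fun a => pmean (prodDist μA n)
        (fun x => D a (fun j => if j ∈ H then ξ j else x j) ^ 2))
    have h2 := pmean_mono hμA fun a => sq_pmean_le hp
        (fun x => D a (fun j => if j ∈ H then ξ j else x j) ^ 2)
    simp only [← pow_mul, Nat.reduceMul] at h2
    linarith
  have hmix (a : A) := pmean_pmean_mix hμA H (fun x => D a x ^ 4)
  have h2 := pmean_mono hμA fun a => pmean_pow_four_le hμA hL hμL (hD a)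
  rw [pmean_const_mul] at h2
  have h3 := hμL (fun a => pmean (prodDist μA n) (fun x => D a x ^ 2))
    fun a => pmean_nonneg hp fun x => sq_nonneg _
  have h4 := mul_le_mul_of_nonneg_left h3 (show 0 ≤ ((4 * L) ^ 2) ^ d by positivity)
  refine (pmean_mono hp hJensen).trans ?_
  rw [pmean_const_mul, pmean_comm]
  simp only [hmix]
  rw [influence_eq_pmean]
  change _ ≤ ((4 * L) ^ 2) ^ d * L * (1 / 2 * pmean μA (fun a =>
    pmean (prodDist μA n) (fun x => D a x ^ 2))) ^ 2
  linarith

end product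

/-- Regularity lemma for degree-`d` functions (Lemma 5.2): there is `h = h(μ_A,d,τ)`
such that any degree-`d` function `P` with variance at most 1 admits a set `H₀` of at most `h`
coordinates such that for any superset `H`, a random restriction of the `H`-coordinates leaves
all remaining influences at most `τ`, with probability at least `1 - τ`. -/
theorem stmt4 {A : Type*} [Fintype A] (μA : A → ℝ) (hμA : IsDist μA)
    (d : ℕ) (τ : ℝ) (hτ : 0 < τ) :
    ∃ h : ℕ, ∀ n : ℕ, ∀ P : (Fin n → A) → ℝ, degLE d P → pvar (prodDist μA n) P ≤ 1 →
      ∃ H₀ : Finset (Fin n), H₀.card ≤ h ∧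
        ∀ H : Finset (Fin n), H₀ ⊆ H →
          pprob (prodDist μA n)
            (fun ξ => ∀ i ∉ H, influence μA i (restrictFn H ξ P) ≤ τ) ≥ 1 - τ := by
  obtain ⟨L, hL, hμL⟩ := exists_pmean_sq_le μA hμA
  have hC : 0 < ((4 * L) ^ 2) ^ d * L := by positivity
  set C := ((4 * L) ^ 2) ^ d * L
  set ε := τ ^ 3 / (C * (d + 1)) with hε
  have hε0 : 0 < ε := by positivity
  refine ⟨⌊d / ε⌋₊, fun n P hP hvar => ?_⟩
  have hp := isDist_prodDist hμA n
  have htot : ∑ i, influence μA i P ≤ d :=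
    (totalInfluence_le_mul_pvar hμA hP).trans (mul_le_of_le_one_right d.cast_nonneg hvar)
  refine ⟨Finset.univ.filter fun i => ε < influence μA i P, ?_, fun H hH => ?_⟩
  · refine Nat.le_floor ((le_div_iff₀ hε0).2 (le_trans ?_ htot))
    rw [← nsmul_eq_mul]
    refine (Finset.card_nsmul_le_sum _ (fun i => influence μA i P) ε ?_).trans
      (Finset.sum_le_univ_sum_of_nonneg fun i => influence_nonneg hμA i P)
    intro i hi
    exact (Finset.mem_filter.1 hi).2.le
  · have hmarkov := pprob_mul_sq_le_sum hp Hᶜ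
      (fun i ξ => influence μA i (restrictFn H ξ P)) hτ
      (E := fun ξ => ¬ ∀ i ∉ H, influence μA i (restrictFn H ξ P) ≤ τ)
      (fun ξ hξ => by simpa using hξ)
    have hsum : ∑ i ∈ Hᶜ, pmean (prodDist μA n)
        (fun ξ => influence μA i (restrictFn H ξ P) ^ 2) ≤ C * ε * d := by
      calc _ ≤ ∑ i ∈ Hᶜ, C * ε * influence μA i P := by
            refine Finset.sum_le_sum fun i hi => ?_
            have hiH : i ∉ H := Finset.mem_compl.1 hi
            have hiε : influence μA i P ≤ ε := by
              by_contra! h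
              exact hiH (hH (by simpa using h))
            refine (pmean_influence_restrictFn_sq_le hμA hL hμL hP H hiH).trans ?_
            rw [sq (influence μA i P), mul_assoc C ε]
            exact mul_le_mul_of_nonneg_left
              (mul_le_mul_of_nonneg_right hiε (influence_nonneg hμA i P)) hC.le
        _ = C * ε * ∑ i ∈ Hᶜ, influence μA i P := by rw [Finset.mul_sum]
        _ ≤ C * ε * d := by
            refine mul_le_mul_of_nonneg_left (le_trans ?_ htot) (by positivity)
            exact Finset.sum_le_univ_sum_of_nonneg fun i => influence_nonneg hμA i P
    have hbound : C * ε * d ≤ τ * τ ^ 2 := by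
      have h : C * ε * (d + 1) = τ * τ ^ 2 := by
        rw [hε]; field_simp
      have : 0 ≤ C * ε := by positivity
      linarith
    have hbad := le_of_mul_le_mul_right (hmarkov.trans (hsum.trans hbound)) (by positivity)
    have := pprob_add_pprob_not hp (fun ξ => ∀ i ∉ H, influence μA i (restrictFn H ξ P) ≤ τ)
    linarith

end NIS
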